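/- Under the SVARM model with K ≥ 1 main-loop pairs and T̄ = 2K, the sample counts satisfy E[1/m_i⁺] = E[1/m_i⁻] ≤ 2Hₙ/T̄. -/

import Mathlib

open Finset
open scoped Classical

noncomputable section

/-- The `n`-th harmonic number `Hₙ = ∑_{k=1}^n 1/k`. -/
def harm (n : ℕ) : ℝ := ∑ k ∈ Finset.range n, (1 : ℝ) / (k + 1)

/-- The player set `N_i = N \ {i}`. -/
def Ni (n : ℕ) (i : Fin n) : Finset (Fin n) := Finset.univ.erase i

/-- The Shapley weights `w_S = 1/(n·C(n−1,|S|))` (defining `P^w` on subsets of `N_i`). -/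
def wgt (n : ℕ) (S : Finset (Fin n)) : ℝ :=
  1 / ((n : ℝ) * (Nat.choose (n - 1) S.card : ℝ))

/-- The SVARM sampling distribution `P⁺(S) = 1/(|S|·C(n,|S|)·Hₙ)` on nonempty `S ⊆ N`
(the formula evaluates to `0` on `S = ∅` by division-by-zero conventions). -/
def Pplus (n : ℕ) (S : Finset (Fin n)) : ℝ :=
  1 / ((S.card : ℝ) * (Nat.choose n S.card : ℝ) * harm n)

/-- The SVARM sampling distribution `P⁻(S) = 1/((n−|S|)·C(n,|S|)·Hₙ)` on proper `S ⊊ N`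
(the formula evaluates to `0` on `S = N` by division-by-zero conventions). -/
def Pminus (n : ℕ) (S : Finset (Fin n)) : ℝ :=
  1 / (((n : ℝ) - (S.card : ℝ)) * (Nat.choose n S.card : ℝ) * harm n)

/-- Sample space of SVARM with `K` main-loop pairs: warm-up samples `B⁺, B⁻` and main
samples `A₁⁺,…,A_K⁺`, `A₁⁻,…,A_K⁻`. -/
abbrev Omega (n K : ℕ) :=
  Finset (Fin n) × Finset (Fin n) × (Fin K → Finset (Fin n)) × (Fin K → Finset (Fin n))

/-- Joint pmf of the mutually independent samples `B⁺, B⁻ ∼ P^w` (subsets of `N_i`),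
`A₁⁺,…,A_K⁺` i.i.d. `∼ P⁺` and `A₁⁻,…,A_K⁻` i.i.d. `∼ P⁻`. -/
def jointP (n K : ℕ) (i : Fin n) (ω : Omega n K) : ℝ :=
  (if ω.1 ⊆ Ni n i then wgt n ω.1 else 0) *
    (if ω.2.1 ⊆ Ni n i then wgt n ω.2.1 else 0) *
    (∏ k, Pplus n (ω.2.2.1 k)) * (∏ k, Pminus n (ω.2.2.2 k))

/-- Expectation with respect to the joint distribution of the SVARM samples. -/
def expVal (n K : ℕ) (i : Fin n) (f : Omega n K → ℝ) : ℝ :=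
  ∑ ω : Omega n K, jointP n K i ω * f ω

/-- Probability of an event under the joint distribution of the SVARM samples. -/
def probEvent (n K : ℕ) (i : Fin n) (E : Omega n K → Prop) : ℝ :=
  ∑ ω : Omega n K, if E ω then jointP n K i ω else 0

/-- The sample count `m_i⁺ = 1 + #{k : i ∈ A_k⁺}`. -/
def mplus (n K : ℕ) (i : Fin n) (ω : Omega n K) : ℕ :=
  1 + (Finset.univ.filter fun k => i ∈ ω.2.2.1 k).card

/-- The sample count `m_i⁻ = 1 + #{k : i ∉ A_k⁻}`. -/
def mminus (n K : ℕ) (i : Fin n) (ω : Omega n K) : ℕ :=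
  1 + (Finset.univ.filter fun k => i ∉ ω.2.2.2 k).card

/-- The estimate `φ̂_i⁺ = (ν(B⁺ ∪ {i}) + ∑_{k : i ∈ A_k⁺} ν(A_k⁺))/m_i⁺`. -/
def phiHatPlus (n K : ℕ) (ν : Finset (Fin n) → ℝ) (i : Fin n) (ω : Omega n K) : ℝ :=
  (ν (insert i ω.1) + ∑ k ∈ Finset.univ.filter (fun k => i ∈ ω.2.2.1 k), ν (ω.2.2.1 k)) /
    (mplus n K i ω : ℝ)

/-- The estimate `φ̂_i⁻ = (ν(B⁻) + ∑_{k : i ∉ A_k⁻} ν(A_k⁻))/m_i⁻`. -/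
def phiHatMinus (n K : ℕ) (ν : Finset (Fin n) → ℝ) (i : Fin n) (ω : Omega n K) : ℝ :=
  (ν ω.2.1 + ∑ k ∈ Finset.univ.filter (fun k => i ∉ ω.2.2.2 k), ν (ω.2.2.2 k)) /
    (mminus n K i ω : ℝ)

/-- The SVARM estimator `φ̂_i = φ̂_i⁺ − φ̂_i⁻`. -/
def phiHat (n K : ℕ) (ν : Finset (Fin n) → ℝ) (i : Fin n) (ω : Omega n K) : ℝ :=
  phiHatPlus n K ν i ω - phiHatMinus n K ν i ω

/-- The Shapley value `φ_i = ∑_{S ⊆ N_i} w_S (ν(S∪{i}) − ν(S))`. -/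
def shapley (n : ℕ) (ν : Finset (Fin n) → ℝ) (i : Fin n) : ℝ :=
  ∑ S ∈ (Ni n i).powerset, wgt n S * (ν (insert i S) - ν S)

/-- The positive Shapley value `φ_i⁺ = E[ν(A ∪ {i})]` for `A ∼ P^w`. -/
def phiPlus (n : ℕ) (ν : Finset (Fin n) → ℝ) (i : Fin n) : ℝ :=
  ∑ S ∈ (Ni n i).powerset, wgt n S * ν (insert i S)

/-- The negative Shapley value `φ_i⁻ = E[ν(A)]` for `A ∼ P^w`. -/
def phiMinus (n : ℕ) (ν : Finset (Fin n) → ℝ) (i : Fin n) : ℝ :=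
  ∑ S ∈ (Ni n i).powerset, wgt n S * ν S

/-- The variance `σ_i⁺² = Var[ν(A ∪ {i})]` for `A ∼ P^w`. -/
def sigPlusSq (n : ℕ) (ν : Finset (Fin n) → ℝ) (i : Fin n) : ℝ :=
  ∑ S ∈ (Ni n i).powerset, wgt n S * (ν (insert i S) - phiPlus n ν i) ^ 2

/-- The variance `σ_i⁻² = Var[ν(A)]` for `A ∼ P^w`. -/
def sigMinusSq (n : ℕ) (ν : Finset (Fin n) → ℝ) (i : Fin n) : ℝ :=
  ∑ S ∈ (Ni n i).powerset, wgt n S * (ν S - phiMinus n ν i) ^ 2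

end

lemma harm_pos {n : ℕ} (hn : 1 ≤ n) : 0 < harm n :=
  Finset.sum_pos (fun k _ => by positivity) ⟨0, Finset.mem_range.2 hn⟩

lemma wgt_sum_eq_one {n : ℕ} (i : Fin n) : ∑ S ∈ (Ni n i).powerset, wgt n S = 1 := by
  obtain _ | m := n
  · exact i.elim0
  unfold wgt
  rw [Finset.sum_powerset_apply_card (fun s => 1 / (((m + 1 : ℕ) : ℝ) * ((m + 1 - 1).choose s : ℝ)))]
  have hcard : (Ni (m + 1) i).card = m := by simp [Ni]
  rw [hcard, Finset.sum_congr rfl (g := fun _ => 1 / ((m + 1 : ℕ) : ℝ))]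
  · simp only [Finset.sum_const, Finset.card_range, nsmul_eq_mul]
    field_simp
  · intro s hs
    have h : ((m.choose s : ℕ) : ℝ) ≠ 0 := by
      exact_mod_cast (Nat.choose_pos (by simpa [Nat.lt_succ_iff] using hs)).ne'
    simp only [nsmul_eq_mul, Nat.add_sub_cancel]
    field_simp

lemma Pplus_sum_eq_one {n : ℕ} (hn : 1 ≤ n) : ∑ S : Finset (Fin n), Pplus n S = 1 := by
  unfold Pplus
  rw [← Finset.powerset_univ,
    Finset.sum_powerset_apply_card (fun s => 1 / ((s : ℝ) * (n.choose s : ℝ) * harm n))]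
  have hH := harm_pos hn
  rw [Finset.card_univ, Fintype.card_fin, Finset.sum_range_succ']
  simp only [Nat.cast_zero, zero_mul, div_zero, smul_zero, add_zero]
  rw [Finset.sum_congr rfl (g := fun k : ℕ => 1 / ((k : ℝ) + 1) / harm n)]
  · rw [← Finset.sum_div]
    exact div_self hH.ne'
  · intro s hs
    have h : ((n.choose (s + 1) : ℕ) : ℝ) ≠ 0 := by
      exact_mod_cast (Nat.choose_pos (by simpa using hs)).ne'
    simp only [nsmul_eq_mul]
    push_cast
    field_simp

lemma Pplus_insert {n : ℕ} {i : Fin n} {S : Finset (Fin n)} (hS : i ∉ S) :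
    Pplus n (insert i S) = wgt n S / harm n := by
  obtain _ | m := n
  · exact i.elim0
  have h : ((m + 1 : ℕ) : ℝ) * (m.choose S.card : ℝ)
      = ((S.card + 1 : ℕ) : ℝ) * ((m + 1).choose (S.card + 1) : ℝ) := by
    rw [mul_comm ((S.card + 1 : ℕ) : ℝ)]
    exact_mod_cast Nat.add_one_mul_choose_eq m S.card
  rw [Pplus, wgt, Finset.card_insert_of_notMem hS, Nat.add_sub_cancel, h, div_div]

lemma Pplus_sum_mem {n : ℕ} (i : Fin n) :
    ∑ S : Finset (Fin n) with i ∈ S, Pplus n S = 1 / harm n := by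
  rw [← wgt_sum_eq_one i, Finset.sum_div]
  symm
  refine Finset.sum_bij' (fun S _ => insert i S) (fun S _ => S.erase i) ?_ ?_ ?_ ?_ ?_
  · simp
  · intro S _
    exact Finset.mem_powerset.2 (Finset.erase_subset_erase i (Finset.subset_univ S))
  · intro S hS
    exact Finset.erase_insert fun h => by simpa [Ni] using Finset.mem_powerset.1 hS h
  · intro S hS
    exact Finset.insert_erase (by simpa using hS)
  · intro S hS
    exact (Pplus_insert fun h => by simpa [Ni] using Finset.mem_powerset.1 hS h).symm

lemma Pplus_compl (n : ℕ) (S : Finset (Fin n)) : Pplus n Sᶜ = Pminus n S := by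
  have h : S.card ≤ n := by simpa using Finset.card_le_univ S
  rw [Pplus, Pminus, Finset.card_compl, Fintype.card_fin, Nat.choose_symm h, Nat.cast_sub h]

lemma Pminus_compl (n : ℕ) (S : Finset (Fin n)) : Pminus n Sᶜ = Pplus n S := by
  rw [← Pplus_compl, compl_compl]

lemma Pminus_sum_eq_one {n : ℕ} (hn : 1 ≤ n) : ∑ S : Finset (Fin n), Pminus n S = 1 := by
  rw [← Pplus_sum_eq_one hn, ← (Equiv.sum_comp (compl_involutive.toPerm) (Pplus n))]
  exact Finset.sum_congr rfl fun S _ => (Pplus_compl n S).symm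

/-- Swapping the two families of main samples while complementing each coalition. -/
def swapCompl (n K : ℕ) : Omega n K ≃ Omega n K where
  toFun ω := (ω.1, ω.2.1, fun k => (ω.2.2.2 k)ᶜ, fun k => (ω.2.2.1 k)ᶜ)
  invFun ω := (ω.1, ω.2.1, fun k => (ω.2.2.2 k)ᶜ, fun k => (ω.2.2.1 k)ᶜ)
  left_inv ω := by simp
  right_inv ω := by simp

lemma expVal_inv_mplus_eq (n K : ℕ) (i : Fin n) :
    expVal n K i (fun ω => 1 / (mplus n K i ω : ℝ))
      = expVal n K i (fun ω => 1 / (mminus n K i ω : ℝ)) := by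
  unfold expVal
  rw [← Equiv.sum_comp (swapCompl n K)]
  refine Finset.sum_congr rfl fun ω _ => ?_
  simp only [jointP, mplus, mminus, swapCompl, Equiv.coe_fn_mk, Pplus_compl, Pminus_compl,
    Finset.mem_compl]
  congr 1
  exact mul_right_comm _ _ _

lemma expVal_of_main_plus {n : ℕ} (K : ℕ) (hn : 1 ≤ n) (i : Fin n)
    (g : (Fin K → Finset (Fin n)) → ℝ) :
    expVal n K i (fun ω => g ω.2.2.1)
      = ∑ A : Fin K → Finset (Fin n), (∏ k, Pplus n (A k)) * g A := by
  have hw : ∑ S : Finset (Fin n), (if S ⊆ Ni n i then wgt n S else 0) = 1 := by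
    rw [← Finset.sum_filter, ← wgt_sum_eq_one i]
    exact Finset.sum_congr (by ext; simp) fun _ _ => rfl
  have hm : ∑ A : Fin K → Finset (Fin n), ∏ k, Pminus n (A k) = 1 := by
    rw [← Fintype.prod_sum fun (_ : Fin K) S => Pminus n S]
    simp [Pminus_sum_eq_one hn]
  unfold expVal jointP
  calc _ = ∑ B, ∑ C, ∑ A : Fin K → Finset (Fin n), ∑ D : Fin K → Finset (Fin n),
        (if B ⊆ Ni n i then wgt n B else 0) * ((if C ⊆ Ni n i then wgt n C else 0) *
          (((∏ k, Pplus n (A k)) * g A) * ∏ k, Pminus n (D k))) := by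
        simp only [Fintype.sum_prod_type]
        refine Finset.sum_congr rfl fun B _ => Finset.sum_congr rfl fun C _ =>
          Finset.sum_congr rfl fun A _ => Finset.sum_congr rfl fun D _ => ?_
        ring
    _ = _ := by
        simp only [← Finset.mul_sum, hm, mul_one, ← Finset.sum_mul, hw, one_mul]

/-- For i.i.d. samples from a finite distribution, the number of successes `X` among `K` trials
with success probability `p` satisfies `p · E[1/(1+X)] ≤ 1/(K+1)`. -/
lemma mul_sum_prod_div_one_add_card_le {α : Type*} [Fintype α] (P : α → ℝ) (s : α → Prop) [DecidablePred s]
    (hP : ∀ a, 0 ≤ P a) (hP1 : ∑ a, P a = 1) (K : ℕ) :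
    (∑ a with s a, P a) * ∑ A : Fin K → α, (∏ k, P (A k)) *
      (1 / ((1 + (Finset.univ.filter fun k => s (A k)).card : ℕ) : ℝ)) ≤ 1 / ((K : ℝ) + 1) := by
  set p := ∑ a with s a, P a with hp
  set q := ∑ a with ¬ s a, P a with hq
  have hpq : p + q = 1 := by rw [hp, hq, Finset.sum_filter_add_sum_filter_not, hP1]
  have hq0 : 0 ≤ q := Finset.sum_nonneg fun a _ => hP a
  have hgen (x : ℝ) : ∑ A : Fin K → α, (∏ k, P (A k)) *
      x ^ (Finset.univ.filter fun k => s (A k)).card = (p * x + q) ^ K := by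
    have h1 : p * x + q = ∑ a, P a * (if s a then x else 1) := by
      rw [← Finset.sum_filter_add_sum_filter_not Finset.univ s, hp, hq, Finset.sum_mul]
      congr 1 <;> refine Finset.sum_congr rfl fun a ha => ?_ <;>
        simp [(Finset.mem_filter.1 ha).2]
    rw [h1, ← Fin.prod_const, Fintype.prod_sum]
    refine Finset.sum_congr rfl fun A _ => ?_
    rw [Finset.prod_mul_distrib, Finset.prod_ite]
    simp
  have hint : ∑ A : Fin K → α, (∏ k, P (A k)) *
      (1 / ((1 + (Finset.univ.filter fun k => s (A k)).card : ℕ) : ℝ))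
      = ∫ x in (0 : ℝ)..1, (p * x + q) ^ K := by
    simp only [← hgen]
    rw [intervalIntegral.integral_finsetSum]
    · refine Finset.sum_congr rfl fun A _ => ?_
      rw [intervalIntegral.integral_const_mul, integral_pow]
      simp [add_comm]
    · intro A _
      exact (by fun_prop : Continuous _).intervalIntegrable _ _
  have hsubst : p * ∫ x in (0 : ℝ)..1, (p * x + q) ^ K = ∫ y in p * 0 + q..p * 1 + q, y ^ K :=
    intervalIntegral.mul_integral_comp_mul_add (f := fun y : ℝ => y ^ K) p q
  rw [hint, hsubst, integral_pow, mul_one, mul_zero, zero_add, hpq, one_pow]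
  gcongr
  linarith [pow_nonneg hq0 (K + 1)]

/-- With `T̄ = 2K`, the sample counts satisfy `E[1/m_i⁺] = E[1/m_i⁻] ≤ 2Hₙ/T̄`. -/
theorem stmt10 (n K : ℕ) (hn : 1 ≤ n) (hK : 1 ≤ K) (i : Fin n) :
    expVal n K i (fun ω => 1 / (mplus n K i ω : ℝ))
        = expVal n K i (fun ω => 1 / (mminus n K i ω : ℝ)) ∧
    expVal n K i (fun ω => 1 / (mplus n K i ω : ℝ)) ≤ 2 * harm n / (2 * (K : ℝ)) := by
  refine ⟨expVal_inv_mplus_eq n K i, ?_⟩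
  have hH := harm_pos hn
  have hK' : (0 : ℝ) < K := by exact_mod_cast hK
  have hP (S : Finset (Fin n)) : 0 ≤ Pplus n S := by unfold Pplus; positivity
  have h := mul_sum_prod_div_one_add_card_le (Pplus n) (fun S => i ∈ S) hP
    (Pplus_sum_eq_one hn) K
  rw [Pplus_sum_mem, one_div_mul_eq_div, div_le_iff₀ hH] at h
  calc expVal n K i (fun ω => 1 / (mplus n K i ω : ℝ))
      ≤ 1 / ((K : ℝ) + 1) * harm n := by
        refine le_of_eq_of_le ?_ h
        exact expVal_of_main_plus K hn i fun A =>
          1 / ((1 + (Finset.univ.filter fun k => i ∈ A k).card : ℕ) : ℝ)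
    _ ≤ 1 / (K : ℝ) * harm n := by
        gcongr
        linarith
    _ = 2 * harm n / (2 * (K : ℝ)) := by field_simp
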